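/- Let |G⟩ be an n-qubit graph state with stabilizer S, let S_d be the subgroup of S generated by all elements of weight at most d, let η(|G⟩) be the minimal d with S_d = S, and suppose d < η(|G⟩). If H' is any d-body Hamiltonian on n qubits having |G⟩ as a ground state, then the eigenspace of H' for its smallest eigenvalue has dimension at least 2^n · |S_d|^{−1}. -/

import Mathlib

open Matrix BigOperators
open scoped Classical

noncomputable section

/-- The state space of `n` qubits, `(ℂ²)^{⊗n}`, realized as functions from bit strings to `ℂ`. -/
abbrev QState (n : ℕ) : Type := (Fin n → Fin 2) → ℂ

/-- Operators on `n` qubits. -/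
abbrev QOp (n : ℕ) : Type := Matrix (Fin n → Fin 2) (Fin n → Fin 2) ℂ

/-- The single qubit Pauli matrices: `0 ↦ σ₀ = I`, `1 ↦ σ_x`, `2 ↦ σ_y`, `3 ↦ σ_z`. -/
def pauli1 (k : Fin 4) : Matrix (Fin 2) (Fin 2) ℂ :=
  if k = 0 then 1
  else if k = 1 then !![0, 1; 1, 0]
  else if k = 2 then !![0, -Complex.I; Complex.I, 0]
  else !![1, 0; 0, -1]

/-- The `n`-qubit Pauli operator `σ_{f 0} ⊗ σ_{f 1} ⊗ ⋯ ⊗ σ_{f (n-1)}`. -/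
def pauliOp {n : ℕ} (f : Fin n → Fin 4) : QOp n :=
  Matrix.of fun v w => ∏ i, pauli1 (f i) (v i) (w i)

/-- The support of a Pauli operator: the qubits on which it acts nontrivially. -/
def pSupport {n : ℕ} (f : Fin n → Fin 4) : Finset (Fin n) :=
  Finset.univ.filter fun i => f i ≠ 0

/-- The weight of a Pauli operator: the number of qubits on which it acts nontrivially. -/
def pWeight {n : ℕ} (f : Fin n → Fin 4) : ℕ := (pSupport f).card

/-- `g` is the signed Pauli operator `±σ_f`. -/
def IsSignedPauli {n : ℕ} (g : QOp n) (f : Fin n → Fin 4) : Prop :=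
  g = pauliOp f ∨ g = -pauliOp f

/-- The squared norm `∑_v |ψ_v|²` of an `n`-qubit state. -/
def qNormSq {n : ℕ} (ψ : QState n) : ℝ := ∑ v, Complex.normSq (ψ v)

/-- The inner product `⟨φ|ψ⟩` (antilinear in the first argument). -/
def qInner {n : ℕ} (φ ψ : QState n) : ℂ := ∑ v, starRingEnd ℂ (φ v) * ψ v

/-- The graph state correlation operator `K_a = σ_x^(a) ∏_{b ∈ N(a)} σ_z^(b)`. -/
def Kop {n : ℕ} (G : SimpleGraph (Fin n)) [DecidableRel G.Adj] (a : Fin n) : QOp n :=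
  pauliOp fun b => if b = a then 1 else if G.Adj a b then 3 else 0

/-- `ψ` is the graph state `|G⟩`: a unit vector fixed by all correlation operators `K_a`. -/
def IsGraphState {n : ℕ} (G : SimpleGraph (Fin n)) [DecidableRel G.Adj] (ψ : QState n) : Prop :=
  qNormSq ψ = 1 ∧ ∀ a : Fin n, Kop G a *ᵥ ψ = ψ

/-- The stabilizer of `ψ`: all signed Pauli operators `g = ±σ` with `g ψ = ψ`. -/
def stab {n : ℕ} (ψ : QState n) : Set (QOp n) :=
  {g | (∃ f, IsSignedPauli g f) ∧ g *ᵥ ψ = ψ}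

/-- The stabilizer elements of weight at most `d`. -/
def stabW {n : ℕ} (ψ : QState n) (d : ℕ) : Set (QOp n) :=
  {g | g ∈ stab ψ ∧ ∃ f, IsSignedPauli g f ∧ pWeight f ≤ d}

/-- `S_d`: the subgroup of the stabilizer generated by all elements of weight at most `d`,
as a set of operators.  (Since the stabilizer is a finite group, the generated submonoid
coincides with the generated subgroup.) -/
def SdSet {n : ℕ} (ψ : QState n) (d : ℕ) : Set (QOp n) :=
  (Submonoid.closure (stabW ψ d) : Set (QOp n))

/-- `δ(|ψ⟩)`: the minimal weight of a nonidentity element of the stabilizer of `ψ`. -/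
def deltaG {n : ℕ} (ψ : QState n) : ℕ :=
  sInf {d | ∃ g ∈ stab ψ, g ≠ 1 ∧ ∃ f, IsSignedPauli g f ∧ pWeight f = d}

/-- `η(|ψ⟩)`: the minimal `d` such that `S_d = S`. -/
def etaG {n : ℕ} (ψ : QState n) : ℕ :=
  sInf {d | stab ψ ⊆ SdSet ψ d}

/-- A `d`-body Hamiltonian on `n` qubits: a real linear combination of Pauli operators
of weight at most `d`. -/
def IsDBody {n : ℕ} (d : ℕ) (H : QOp n) : Prop :=
  ∃ h : (Fin n → Fin 4) → ℝ, (∀ f, d < pWeight f → h f = 0) ∧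
    H = ∑ f : Fin n → Fin 4, (h f : ℂ) • pauliOp f

/-- A Hamiltonian is nontrivial if it is nonzero and not a multiple of the identity. -/
def NontrivialHam {n : ℕ} (H : QOp n) : Prop :=
  H ≠ 0 ∧ ∀ c : ℂ, H ≠ c • (1 : QOp n)

/-- `φ` is an eigenvector of `H` with (real) eigenvalue `E`. -/
def IsEigenpair {n : ℕ} (H : QOp n) (E : ℝ) (φ : QState n) : Prop :=
  φ ≠ 0 ∧ H *ᵥ φ = (E : ℂ) • φ

/-- `ψ` is a ground state of `H` with ground energy `E`: an eigenvector for the smallest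
eigenvalue `E` of `H`. -/
def IsGroundStateE {n : ℕ} (H : QOp n) (ψ : QState n) (E : ℝ) : Prop :=
  IsEigenpair H E ψ ∧ ∀ E' φ, IsEigenpair H E' φ → E ≤ E'

/-- `ψ` is a ground state of `H`. -/
def IsGroundState {n : ℕ} (H : QOp n) (ψ : QState n) : Prop :=
  ∃ E, IsGroundStateE H ψ E

/-- The dimension of the eigenspace of `H` for the eigenvalue `E` (the multiplicity of `E`). -/
def eigDim {n : ℕ} (H : QOp n) (E : ℝ) : ℕ :=
  Module.finrank ℂ (Module.End.eigenspace (Matrix.mulVecLin H) ((E : ℂ)))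


/-- The tensor product of a family of single qubit operators. -/
def tensorOp {n : ℕ} (A : Fin n → Matrix (Fin 2) (Fin 2) ℂ) : QOp n :=
  Matrix.of fun v w => ∏ i, A i (v i) (w i)

theorem pauliOp_eq_tensorOp {n : ℕ} (f : Fin n → Fin 4) :
    pauliOp f = tensorOp fun i => pauli1 (f i) := rfl

theorem tensorOp_mul {n : ℕ} (A B : Fin n → Matrix (Fin 2) (Fin 2) ℂ) :
    tensorOp A * tensorOp B = tensorOp fun i => A i * B i := by
  ext v w
  simp only [tensorOp, Matrix.mul_apply, Matrix.of_apply, Finset.prod_univ_sum,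
    Fintype.piFinset_univ, Finset.prod_mul_distrib]

theorem tensorOp_smul {n : ℕ} (c : Fin n → ℂ) (A : Fin n → Matrix (Fin 2) (Fin 2) ℂ) :
    (tensorOp fun i => c i • A i) = (∏ i, c i) • tensorOp A := by
  ext v w
  simp [tensorOp, Finset.prod_mul_distrib]

theorem trace_tensorOp {n : ℕ} (A : Fin n → Matrix (Fin 2) (Fin 2) ℂ) :
    (tensorOp A).trace = ∏ i, (A i).trace := by
  simp only [tensorOp, Matrix.trace, Matrix.diag, Matrix.of_apply, Finset.prod_univ_sum,
    Fintype.piFinset_univ]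

theorem tensorOp_conjTranspose {n : ℕ} (A : Fin n → Matrix (Fin 2) (Fin 2) ℂ) :
    (tensorOp A)ᴴ = tensorOp fun i => (A i)ᴴ := by
  ext v w
  simp [tensorOp, Matrix.conjTranspose_apply]

theorem tensorOp_one {n : ℕ} : tensorOp (fun _ : Fin n => 1) = 1 := by
  ext v w
  by_cases h : v = w
  · subst h
    rw [Matrix.one_apply_eq]
    simp [tensorOp]
  · obtain ⟨i, hi⟩ := Function.ne_iff.mp h
    rw [Matrix.one_apply_ne h]
    exact Finset.prod_eq_zero (Finset.mem_univ i) (Matrix.one_apply_ne hi)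

theorem pauli1_mul_self (a : Fin 4) : pauli1 a * pauli1 a = 1 := by
  fin_cases a <;> ext i j <;> fin_cases i <;> fin_cases j <;> simp [pauli1]

theorem pauli1_conjTranspose (a : Fin 4) : (pauli1 a)ᴴ = pauli1 a := by
  fin_cases a <;> ext i j <;> fin_cases i <;> fin_cases j <;> simp [pauli1]

theorem trace_pauli1_mul_of_ne {a b : Fin 4} (h : a ≠ b) :
    (pauli1 a * pauli1 b).trace = 0 := by
  fin_cases a <;> fin_cases b <;>
    first
    | exact absurd rfl h
    | simp [pauli1, Matrix.trace_fin_two]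

theorem pauli1_mul_comm_or_anticomm (a b : Fin 4) :
    ∃ s : ℂ, (s = 1 ∨ s = -1) ∧ pauli1 a * pauli1 b = s • (pauli1 b * pauli1 a) := by
  fin_cases a <;> fin_cases b <;>
    first
    | (refine ⟨1, Or.inl rfl, ?_⟩
       ext i j; fin_cases i <;> fin_cases j <;> simp [pauli1]; done)
    | (refine ⟨-1, Or.inr rfl, ?_⟩
       ext i j; fin_cases i <;> fin_cases j <;> simp [pauli1])

theorem pauli1_mul (a b : Fin 4) :
    ∃ (c : ℂ) (k : Fin 4), pauli1 a * pauli1 b = c • pauli1 k := by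
  have h0 : ∀ k : Fin 4, pauli1 0 * pauli1 k = (1 : ℂ) • pauli1 k := fun k => by simp [pauli1]
  have h0' : ∀ k : Fin 4, pauli1 k * pauli1 0 = (1 : ℂ) • pauli1 k := fun k => by simp [pauli1]
  have hs : ∀ k : Fin 4, pauli1 k * pauli1 k = (1 : ℂ) • pauli1 0 := fun k => by
    rw [pauli1_mul_self]; simp [pauli1]
  have hxy : pauli1 1 * pauli1 2 = Complex.I • pauli1 3 := by
    ext i j; fin_cases i <;> fin_cases j <;> simp [pauli1]
  have hyx : pauli1 2 * pauli1 1 = (-Complex.I) • pauli1 3 := by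
    ext i j; fin_cases i <;> fin_cases j <;> simp [pauli1]
  have hyz : pauli1 2 * pauli1 3 = Complex.I • pauli1 1 := by
    ext i j; fin_cases i <;> fin_cases j <;> simp [pauli1]
  have hzy : pauli1 3 * pauli1 2 = (-Complex.I) • pauli1 1 := by
    ext i j; fin_cases i <;> fin_cases j <;> simp [pauli1]
  have hzx : pauli1 3 * pauli1 1 = Complex.I • pauli1 2 := by
    ext i j; fin_cases i <;> fin_cases j <;> simp [pauli1]
  have hxz : pauli1 1 * pauli1 3 = (-Complex.I) • pauli1 2 := by
    ext i j; fin_cases i <;> fin_cases j <;> simp [pauli1]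
  have hcases : a = 0 ∨ b = 0 ∨ a = b ∨ (a = 1 ∧ b = 2) ∨ (a = 2 ∧ b = 1) ∨ (a = 2 ∧ b = 3) ∨
      (a = 3 ∧ b = 2) ∨ (a = 3 ∧ b = 1) ∨ (a = 1 ∧ b = 3) := by omega
  rcases hcases with rfl | rfl | rfl | ⟨rfl, rfl⟩ | ⟨rfl, rfl⟩ | ⟨rfl, rfl⟩ | ⟨rfl, rfl⟩ |
    ⟨rfl, rfl⟩ | ⟨rfl, rfl⟩
  · exact ⟨_, _, h0 _⟩
  · exact ⟨_, _, h0' _⟩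
  · exact ⟨_, _, hs _⟩
  · exact ⟨_, _, hxy⟩
  · exact ⟨_, _, hyx⟩
  · exact ⟨_, _, hyz⟩
  · exact ⟨_, _, hzy⟩
  · exact ⟨_, _, hzx⟩
  · exact ⟨_, _, hxz⟩

theorem pauliOp_zero {n : ℕ} : pauliOp (0 : Fin n → Fin 4) = 1 := by
  rw [pauliOp_eq_tensorOp, ← tensorOp_one]
  simp [pauli1]

theorem pauliOp_mul_self {n : ℕ} (f : Fin n → Fin 4) : pauliOp f * pauliOp f = 1 := by
  simp only [pauliOp_eq_tensorOp, tensorOp_mul, pauli1_mul_self, tensorOp_one]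

theorem pauliOp_isHermitian {n : ℕ} (f : Fin n → Fin 4) : (pauliOp f).IsHermitian := by
  simp only [Matrix.IsHermitian, pauliOp_eq_tensorOp, tensorOp_conjTranspose,
    pauli1_conjTranspose]

theorem trace_pauliOp_mul_of_ne {n : ℕ} {f g : Fin n → Fin 4} (h : f ≠ g) :
    (pauliOp f * pauliOp g).trace = 0 := by
  obtain ⟨i, hi⟩ := Function.ne_iff.mp h
  rw [pauliOp_eq_tensorOp, pauliOp_eq_tensorOp, tensorOp_mul, trace_tensorOp]
  exact Finset.prod_eq_zero (Finset.mem_univ i) (trace_pauli1_mul_of_ne hi)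

theorem pauliOp_mul {n : ℕ} (f g : Fin n → Fin 4) :
    ∃ (c : ℂ) (k : Fin n → Fin 4), pauliOp f * pauliOp g = c • pauliOp k := by
  choose c k h using fun i => pauli1_mul (f i) (g i)
  refine ⟨∏ i, c i, k, ?_⟩
  simp only [pauliOp_eq_tensorOp, tensorOp_mul, h, tensorOp_smul]

theorem pauliOp_mul_comm_or_anticomm {n : ℕ} (f g : Fin n → Fin 4) :
    ∃ s : ℂ, (s = 1 ∨ s = -1) ∧ pauliOp f * pauliOp g = s • (pauliOp g * pauliOp f) := by
  choose s hs h using fun i => pauli1_mul_comm_or_anticomm (f i) (g i)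
  refine ⟨∏ i, s i, ?_, ?_⟩
  · exact Finset.prod_induction s (fun z => z = 1 ∨ z = -1)
      (by rintro a b (rfl | rfl) (rfl | rfl) <;> simp) (Or.inl rfl) fun i _ => hs i
  · simp only [pauliOp_eq_tensorOp, tensorOp_mul, h, tensorOp_smul]

theorem eq_one_or_neg_one_of_pauliOp_mulVec {n : ℕ} {ψ : QState n} (hψ : ψ ≠ 0)
    {f : Fin n → Fin 4} {c : ℂ} (h : pauliOp f *ᵥ ψ = c • ψ) : c = 1 ∨ c = -1 := by
  have h2 : pauliOp f *ᵥ (pauliOp f *ᵥ ψ) = ψ := by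
    rw [Matrix.mulVec_mulVec, pauliOp_mul_self, Matrix.one_mulVec]
  rw [h, Matrix.mulVec_smul, h, smul_smul] at h2
  have h3 : (c * c - 1) • ψ = 0 := by rw [sub_smul, h2, one_smul, sub_self]
  have h4 := (smul_eq_zero.mp h3).resolve_right hψ
  exact mul_self_eq_one_iff.mp (sub_eq_zero.mp h4)

theorem mul_mem_stab {n : ℕ} {ψ : QState n} (hψ : ψ ≠ 0) {a b : QOp n}
    (ha : a ∈ stab ψ) (hb : b ∈ stab ψ) : a * b ∈ stab ψ := by
  obtain ⟨⟨f, hf⟩, ha⟩ := ha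
  obtain ⟨⟨g, hg⟩, hb⟩ := hb
  have hab : (a * b) *ᵥ ψ = ψ := by rw [← Matrix.mulVec_mulVec, hb, ha]
  refine ⟨?_, hab⟩
  have hc : ∃ (c : ℂ) (k : Fin n → Fin 4), a * b = c • pauliOp k := by
    obtain ⟨c, k, h⟩ := pauliOp_mul f g
    rcases hf with rfl | rfl <;> rcases hg with rfl | rfl
    · exact ⟨c, k, h⟩
    · exact ⟨-c, k, by simp [h]⟩
    · exact ⟨-c, k, by simp [h]⟩
    · exact ⟨c, k, by simp [h]⟩
  obtain ⟨c, k, h⟩ := hc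
  rw [h, Matrix.smul_mulVec] at hab
  have hc0 : c ≠ 0 := by
    rintro rfl
    exact hψ (by rw [← hab, zero_smul])
  have hk : pauliOp k *ᵥ ψ = c⁻¹ • ψ := by rw [← hab, smul_smul, inv_mul_cancel₀ hc0, one_smul,
    hab]
  refine ⟨k, ?_⟩
  rcases eq_one_or_neg_one_of_pauliOp_mulVec hψ hk with hc | hc
  · rw [inv_eq_one.mp hc, one_smul] at h
    exact Or.inl h
  · rw [inv_eq_iff_eq_inv, inv_neg_one] at hc
    rw [hc, neg_one_smul] at h
    exact Or.inr h

theorem one_mem_stab {n : ℕ} (ψ : QState n) : (1 : QOp n) ∈ stab ψ :=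
  ⟨⟨0, Or.inl pauliOp_zero.symm⟩, Matrix.one_mulVec ψ⟩

theorem SdSet_subset_stab {n : ℕ} {ψ : QState n} (hψ : ψ ≠ 0) (d : ℕ) :
    SdSet ψ d ⊆ stab ψ := fun _ hg =>
  Submonoid.closure_induction (fun _ h => h.1) (one_mem_stab ψ)
    (fun _ _ _ _ ha hb => mul_mem_stab hψ ha hb) hg

theorem mul_mem_SdSet {n : ℕ} {ψ : QState n} {d : ℕ} {a b : QOp n}
    (ha : a ∈ SdSet ψ d) (hb : b ∈ SdSet ψ d) : a * b ∈ SdSet ψ d :=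
  Submonoid.mul_mem _ ha hb

theorem stab_finite {n : ℕ} (ψ : QState n) : (stab ψ).Finite := by
  refine ((Set.finite_range (pauliOp (n := n))).union
    (Set.finite_range fun f : Fin n → Fin 4 => -pauliOp f)).subset ?_
  rintro g ⟨⟨f, rfl | rfl⟩, -⟩
  · exact Or.inl ⟨f, rfl⟩
  · exact Or.inr ⟨f, rfl⟩

theorem mul_self_of_mem_stab {n : ℕ} {ψ : QState n} {g : QOp n} (hg : g ∈ stab ψ) :
    g * g = 1 := by
  obtain ⟨⟨f, rfl | rfl⟩, -⟩ := hg <;> simp [pauliOp_mul_self]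

theorem isHermitian_of_mem_stab {n : ℕ} {ψ : QState n} {g : QOp n} (hg : g ∈ stab ψ) :
    g.IsHermitian := by
  obtain ⟨⟨f, rfl | rfl⟩, -⟩ := hg
  · exact pauliOp_isHermitian f
  · exact (pauliOp_isHermitian f).neg

theorem trace_of_mem_stab {n : ℕ} {ψ : QState n} (hψ : ψ ≠ 0) {g : QOp n} (hg : g ∈ stab ψ)
    (h1 : g ≠ 1) : g.trace = 0 := by
  obtain ⟨⟨f, hf⟩, hg⟩ := hg
  have hf0 : f ≠ 0 := by
    rintro rfl
    rw [IsSignedPauli, pauliOp_zero] at hf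
    rcases hf with rfl | rfl
    · exact h1 rfl
    · rw [Matrix.neg_mulVec, Matrix.one_mulVec] at hg
      exact hψ (neg_eq_self.mp hg)
  have ht := trace_pauliOp_mul_of_ne hf0
  rw [pauliOp_zero, mul_one] at ht
  rcases hf with rfl | rfl <;> simp [ht]

/-- The sum of all elements of `S_d`. -/
def SdSum {n : ℕ} (ψ : QState n) (d : ℕ) : QOp n := ∑ᶠ g ∈ SdSet ψ d, g

section SdSum

variable {n : ℕ} {ψ : QState n}

theorem SdSet_finite (hψ : ψ ≠ 0) (d : ℕ) : (SdSet ψ d).Finite :=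
  (stab_finite ψ).subset (SdSet_subset_stab hψ d)

theorem SdSum_eq (hψ : ψ ≠ 0) (d : ℕ) : SdSum ψ d = ∑ g ∈ (SdSet_finite hψ d).toFinset, g :=
  finsum_mem_eq_finite_toFinset_sum _ _

theorem SdSum_mul_of_mem (hψ : ψ ≠ 0) {d : ℕ} {s : QOp n} (hs : s ∈ SdSet ψ d) :
    SdSum ψ d * s = SdSum ψ d := by
  have hss := mul_self_of_mem_stab (SdSet_subset_stab hψ d hs)
  rw [SdSum_eq hψ, Finset.sum_mul]
  refine Finset.sum_bij' (fun g _ => g * s) (fun g _ => g * s) ?_ ?_ ?_ ?_ ?_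
  · intro g hg
    simp only [Set.Finite.mem_toFinset] at hg ⊢
    exact mul_mem_SdSet hg hs
  · intro g hg
    simp only [Set.Finite.mem_toFinset] at hg ⊢
    exact mul_mem_SdSet hg hs
  · intro g _
    simp [mul_assoc, hss]
  · intro g _
    simp [mul_assoc, hss]
  · intro g _
    rfl

theorem SdSum_mul_self (hψ : ψ ≠ 0) (d : ℕ) :
    SdSum ψ d * SdSum ψ d = ((SdSet ψ d).ncard : ℂ) • SdSum ψ d := by
  conv_lhs => rw [SdSum_eq hψ d, Finset.mul_sum, ← SdSum_eq hψ d]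
  rw [Finset.sum_congr rfl fun g hg =>
    SdSum_mul_of_mem hψ ((SdSet_finite hψ d).mem_toFinset.mp hg), Finset.sum_const,
    Set.ncard_eq_toFinset_card _ (SdSet_finite hψ d), Nat.cast_smul_eq_nsmul]

theorem SdSum_isHermitian (hψ : ψ ≠ 0) (d : ℕ) : (SdSum ψ d).IsHermitian := by
  rw [SdSum_eq hψ, Matrix.IsHermitian, Matrix.conjTranspose_sum]
  exact Finset.sum_congr rfl fun g hg => isHermitian_of_mem_stab
    (SdSet_subset_stab hψ d ((SdSet_finite hψ d).mem_toFinset.mp hg))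

theorem trace_SdSum (hψ : ψ ≠ 0) (d : ℕ) : (SdSum ψ d).trace = 2 ^ n := by
  rw [SdSum_eq hψ, Matrix.trace_sum, Finset.sum_eq_single (1 : QOp n)]
  · simp
  · intro g hg h1
    exact trace_of_mem_stab hψ
      (SdSet_subset_stab hψ d ((SdSet_finite hψ d).mem_toFinset.mp hg)) h1
  · intro h
    exact absurd ((SdSet_finite hψ d).mem_toFinset.mpr (Submonoid.one_mem _)) h

end SdSum

section GraphState

variable {n : ℕ} {G : SimpleGraph (Fin n)} [DecidableRel G.Adj]

theorem eq_zero_of_Kop_mulVec_of_update {φ : QState n} {a : Fin n}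
    (h : Kop G a *ᵥ φ = φ) {v : Fin n → Fin 2} (hv : v a ≠ 0)
    (h0 : φ (Function.update v a 0) = 0) : φ v = 0 := by
  rw [← h, Matrix.mulVec, dotProduct]
  refine Finset.sum_eq_zero fun w _ => ?_
  by_cases hw : w = Function.update v a 0
  · rw [hw, h0, mul_zero]
  · obtain ⟨b, hb⟩ := Function.ne_iff.mp hw
    refine mul_eq_zero_of_left (Finset.prod_eq_zero (Finset.mem_univ b) ?_) _
    by_cases hba : b = a
    · subst hba
      rw [Function.update_self] at hb
      have h1 : v b = 1 := by omega
      have h2 : w b = 1 := by omega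
      simp [h1, h2, pauli1]
    · rw [Function.update_of_ne hba] at hb
      generalize v b = x at hb
      generalize w b = y at hb
      by_cases hab : G.Adj a b
      · simp only [hba, hab, if_true, if_false]
        fin_cases x <;> fin_cases y <;> simp_all [pauli1]
      · simp only [hba, hab, if_false]
        fin_cases x <;> fin_cases y <;> simp_all [pauli1]

theorem eq_zero_of_forall_Kop_mulVec {φ : QState n} (h : ∀ a, Kop G a *ᵥ φ = φ)
    (h0 : φ 0 = 0) : φ = 0 := by
  have key : ∀ (s : Finset (Fin n)) (v : Fin n → Fin 2), (∀ i ∉ s, v i = 0) → φ v = 0 := by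
    intro s
    induction s using Finset.induction_on with
    | empty =>
      intro v hv
      rwa [show v = 0 from funext fun i => hv i (Finset.notMem_empty i)]
    | insert a s _ ih =>
      intro v hv
      by_cases hva : v a = 0
      · refine ih v fun i hi => ?_
        by_cases hia : i = a
        · rw [hia, hva]
        · exact hv i (by simp [hia, hi])
      · refine eq_zero_of_Kop_mulVec_of_update (h a) hva (ih _ fun i hi => ?_)
        by_cases hia : i = a
        · rw [hia, Function.update_self]
        · rw [Function.update_of_ne hia]
          exact hv i (by simp [hia, hi])
  exact funext fun v => key Finset.univ v fun i hi => absurd (Finset.mem_univ i) hi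

theorem exists_eq_smul_of_forall_Kop_mulVec {ψ φ : QState n} (hψ0 : ψ ≠ 0)
    (hψ : ∀ a, Kop G a *ᵥ ψ = ψ) (hφ : ∀ a, Kop G a *ᵥ φ = φ) : ∃ c : ℂ, φ = c • ψ := by
  have h0 : ψ 0 ≠ 0 := fun h => hψ0 (eq_zero_of_forall_Kop_mulVec hψ h)
  refine ⟨φ 0 / ψ 0, ?_⟩
  rw [← sub_eq_zero]
  refine eq_zero_of_forall_Kop_mulVec (G := G) (fun a => ?_) ?_
  · rw [Matrix.mulVec_sub, Matrix.mulVec_smul, hψ, hφ]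
  · simp [h0]

/-- A Pauli operator which is not, up to sign, in the stabilizer of a graph state has vanishing
expectation value. -/
theorem expectation_eq_zero_or_pauliOp_mulVec {ψ : QState n} (hψ0 : ψ ≠ 0)
    (hψ : ∀ a, Kop G a *ᵥ ψ = ψ) (f : Fin n → Fin 4) :
    star ψ ⬝ᵥ (pauliOp f *ᵥ ψ) = 0 ∨ pauliOp f *ᵥ ψ = ψ ∨ pauliOp f *ᵥ ψ = -ψ := by
  by_cases hcomm : ∀ a, pauliOp f * Kop G a = Kop G a * pauliOp f
  · right
    obtain ⟨c, hc⟩ := exists_eq_smul_of_forall_Kop_mulVec (G := G) (φ := pauliOp f *ᵥ ψ) hψ0 hψ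
      fun a => by rw [Matrix.mulVec_mulVec, ← hcomm, ← Matrix.mulVec_mulVec, hψ]
    rcases eq_one_or_neg_one_of_pauliOp_mulVec hψ0 hc with rfl | rfl
    · exact Or.inl (by rw [hc, one_smul])
    · exact Or.inr (by rw [hc, neg_one_smul])
  · left
    push Not at hcomm
    obtain ⟨a, ha⟩ := hcomm
    obtain ⟨s, hs, h⟩ := pauliOp_mul_comm_or_anticomm f
      (fun b => if b = a then 1 else if G.Adj a b then 3 else 0)
    change pauliOp f * Kop G a = s • (Kop G a * pauliOp f) at h
    rcases hs with rfl | rfl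
    · exact absurd (by rw [h, one_smul]) ha
    · have hH : (Kop G a)ᴴ = Kop G a := pauliOp_isHermitian _
      have hstar : star ψ ᵥ* Kop G a = star ψ := by
        conv_rhs => rw [← hψ a, Matrix.star_mulVec, hH]
      have hneg : star ψ ⬝ᵥ (pauliOp f *ᵥ ψ) = -(star ψ ⬝ᵥ (pauliOp f *ᵥ ψ)) := by
        conv_lhs =>
          rw [← hψ a, Matrix.mulVec_mulVec, h, neg_one_smul, Matrix.neg_mulVec,
            dotProduct_neg, ← Matrix.mulVec_mulVec, Matrix.dotProduct_mulVec, hψ a, hstar]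
      exact self_eq_neg.mp hneg

/-- The normalized projector onto the space fixed by `S_d` has the same expectation values on
Pauli operators of weight at most `d` as the graph state. -/
theorem trace_SdSum_mul_pauliOp {ψ : QState n} (hψ0 : ψ ≠ 0) (hnorm : star ψ ⬝ᵥ ψ = 1)
    (hψ : ∀ a, Kop G a *ᵥ ψ = ψ) {d : ℕ} {f : Fin n → Fin 4} (hf : pWeight f ≤ d) :
    (SdSum ψ d * pauliOp f).trace = 2 ^ n * (star ψ ⬝ᵥ (pauliOp f *ᵥ ψ)) := by
  have hmem : ∀ {g : QOp n}, IsSignedPauli g f → g *ᵥ ψ = ψ → g ∈ SdSet ψ d := fun hg h =>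
    Submonoid.subset_closure ⟨⟨⟨f, hg⟩, h⟩, f, hg, hf⟩
  by_cases hp : pauliOp f *ᵥ ψ = ψ
  · rw [SdSum_mul_of_mem hψ0 (hmem (Or.inl rfl) hp), trace_SdSum hψ0, hp, hnorm, mul_one]
  by_cases hm : pauliOp f *ᵥ ψ = -ψ
  · have h := SdSum_mul_of_mem hψ0 (hmem (Or.inr rfl) (by rw [Matrix.neg_mulVec, hm, neg_neg]))
    rw [mul_neg, neg_eq_iff_eq_neg] at h
    rw [h, Matrix.trace_neg, trace_SdSum hψ0, hm, dotProduct_neg, hnorm, mul_neg, mul_one]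
  rw [(expectation_eq_zero_or_pauliOp_mulVec hψ0 hψ f).resolve_right (by tauto), mul_zero,
    SdSum_eq hψ0, Finset.sum_mul, Matrix.trace_sum]
  refine Finset.sum_eq_zero fun g hg => ?_
  obtain ⟨⟨k, hk⟩, hgψ⟩ := SdSet_subset_stab hψ0 d ((SdSet_finite hψ0 d).mem_toFinset.mp hg)
  have hkf : k ≠ f := by
    rintro rfl
    rcases hk with rfl | rfl
    · exact hp hgψ
    · exact hm (by rw [← neg_eq_iff_eq_neg, ← Matrix.neg_mulVec, hgψ])
  rcases hk with rfl | rfl <;> simp [trace_pauliOp_mul_of_ne hkf]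

end GraphState

theorem isHermitian_of_isDBody {n d : ℕ} {H : QOp n} (hH : IsDBody d H) : H.IsHermitian := by
  obtain ⟨h, -, rfl⟩ := hH
  rw [Matrix.IsHermitian, Matrix.conjTranspose_sum]
  refine Finset.sum_congr rfl fun f _ => ?_
  rw [Matrix.conjTranspose_smul, pauliOp_isHermitian f]
  simp

open scoped ComplexOrder in
theorem posSemidef_sub_of_forall_eigenpair {n : ℕ} {H : QOp n} (hH : H.IsHermitian) {E : ℝ}
    (hE : ∀ E' φ, IsEigenpair H E' φ → E ≤ E') : (H - (E : ℂ) • (1 : QOp n)).PosSemidef := by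
  have hB : (H - (E : ℂ) • (1 : QOp n)).IsHermitian := by
    refine hH.sub ?_
    rw [Matrix.IsHermitian, Matrix.conjTranspose_smul]
    simp
  rw [hB.posSemidef_iff_eigenvalues_nonneg]
  intro j
  have hj := hB.mulVec_eigenvectorBasis j
  have hne : (⇑(hB.eigenvectorBasis j) : QState n) ≠ 0 := by
    intro h0
    refine hB.eigenvectorBasis.orthonormal.ne_zero j ?_
    ext v
    exact congrFun h0 v
  have := hE (hB.eigenvalues j + E) _ ⟨hne, by
    rw [Matrix.sub_mulVec, Matrix.smul_mulVec, Matrix.one_mulVec, sub_eq_iff_eq_add] at hj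
    rw [hj, Complex.ofReal_add, add_smul]
    rfl⟩
  simpa using this

theorem trace_eq_finrank_range_of_isIdempotentElem {ι : Type*} [Fintype ι] {P : Matrix ι ι ℂ}
    (hP : IsIdempotentElem P) :
    P.trace = (Module.finrank ℂ (LinearMap.range P.mulVecLin) : ℂ) := by
  have h : IsIdempotentElem P.mulVecLin := by
    rw [IsIdempotentElem, Module.End.mul_eq_comp, ← Matrix.mulVecLin_mul, hP.eq]
  rw [← ((LinearMap.isProj_range_iff_isIdempotentElem _).mpr h).trace, ← Matrix.toLin'_apply',
    Matrix.trace_toLin'_eq]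

open scoped ComplexOrder in
theorem mul_eq_zero_of_posSemidef_of_trace_mul {n : ℕ} {B M : QOp n} (hB : B.PosSemidef)
    (hM : M.IsHermitian) {c : ℂ} (hMM : M * M = c • M) (htr : (M * B).trace = 0) :
    B * M = 0 := by
  have hz : Mᴴ * B * M = 0 := by
    rw [← (hB.conjTranspose_mul_mul_same M).trace_eq_zero_iff, Matrix.trace_mul_cycle, hM.eq,
      hMM, Matrix.smul_mul, Matrix.trace_smul, htr, smul_zero]
  refine Matrix.ext_of_mulVec_single fun i => ?_
  rw [← Matrix.mulVec_mulVec, Matrix.zero_mulVec, ← hB.dotProduct_mulVec_zero_iff, Matrix.star_mulVec,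
    Matrix.mulVec_mulVec, ← Matrix.dotProduct_mulVec, Matrix.mulVec_mulVec, ← mul_assoc, hz]
  simp

/-- let `|G⟩` be an `n`-qubit graph state with stabilizer `S`, and suppose
`d < η(|G⟩)`; write `r = 2^n·|S_d|⁻¹`, i.e. `|S_d| * r = 2^n`.  If `H'` is any `d`-body
Hamiltonian on `n` qubits having `|G⟩` as a ground state, then the eigenspace of `H'` for
its smallest eigenvalue has dimension at least `r = 2^n·|S_d|⁻¹`. -/
theorem ground_space_dimension_lower_bound
    {n : ℕ} (G : SimpleGraph (Fin n)) [DecidableRel G.Adj]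
    (ψ : QState n) (hψ : IsGraphState G ψ)
    (d : ℕ) (hd : d < etaG ψ)
    (r : ℕ) (hr : Set.ncard (SdSet ψ d) * r = 2 ^ n)
    (H' : QOp n) (hH' : IsDBody d H')
    (E : ℝ) (hgs : IsGroundStateE H' ψ E) :
    r ≤ eigDim H' E := by
  have hnorm : star ψ ⬝ᵥ ψ = 1 := by
    have h := congrArg (fun x : ℝ => (x : ℂ)) hψ.1
    simp only [qNormSq, Complex.ofReal_sum, Complex.ofReal_one] at h
    rw [← h]
    exact Finset.sum_congr rfl fun v _ => Complex.normSq_eq_conj_mul_self.symm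
  have hψ0 : ψ ≠ 0 := hgs.1.1
  have hN : ((SdSet ψ d).ncard : ℂ) * r = 2 ^ n := by exact_mod_cast hr
  have hN0 : ((SdSet ψ d).ncard : ℂ) ≠ 0 := by
    intro h
    rw [h, zero_mul] at hN
    exact pow_ne_zero n two_ne_zero hN.symm
  have hB := posSemidef_sub_of_forall_eigenpair (isHermitian_of_isDBody hH') hgs.2
  have htr : (SdSum ψ d * H').trace = 2 ^ n * (star ψ ⬝ᵥ (H' *ᵥ ψ)) := by
    obtain ⟨h, hh, rfl⟩ := hH'
    rw [Finset.mul_sum, Matrix.trace_sum, Matrix.sum_mulVec, dotProduct_sum, Finset.mul_sum]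
    refine Finset.sum_congr rfl fun f _ => ?_
    rw [Matrix.mul_smul, Matrix.trace_smul, Matrix.smul_mulVec, dotProduct_smul]
    by_cases hf : d < pWeight f
    · simp [hh f hf]
    · rw [trace_SdSum_mul_pauliOp hψ0 hnorm hψ.2 (not_lt.mp hf), smul_eq_mul, smul_eq_mul]
      ring
  have hker : (H' - (E : ℂ) • (1 : QOp n)) * SdSum ψ d = 0 := by
    refine mul_eq_zero_of_posSemidef_of_trace_mul hB (SdSum_isHermitian hψ0 d)
      (SdSum_mul_self hψ0 d) ?_
    rw [mul_sub, Matrix.trace_sub, htr, hgs.1.2, dotProduct_smul, hnorm, Matrix.mul_smul,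
      mul_one, Matrix.trace_smul, trace_SdSum hψ0, smul_eq_mul, smul_eq_mul]
    ring
  obtain ⟨P, hP⟩ : ∃ P : QOp n, P = ((SdSet ψ d).ncard : ℂ)⁻¹ • SdSum ψ d := ⟨_, rfl⟩
  have hidem : IsIdempotentElem P := by
    rw [IsIdempotentElem, hP, Matrix.smul_mul, Matrix.mul_smul, SdSum_mul_self hψ0, smul_smul,
      smul_smul, mul_assoc, inv_mul_cancel₀ hN0, mul_one]
  have hrank : Module.finrank ℂ (LinearMap.range P.mulVecLin) = r := by
    have h := trace_eq_finrank_range_of_isIdempotentElem hidem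
    have hPtr : P.trace = r := by
      rw [hP, Matrix.trace_smul, trace_SdSum hψ0, ← hN, smul_eq_mul, inv_mul_cancel_left₀ hN0]
    rw [hPtr] at h
    exact_mod_cast h.symm
  rw [← hrank]
  refine Submodule.finrank_mono ?_
  rintro _ ⟨x, rfl⟩
  have hPx : (H' - (E : ℂ) • (1 : QOp n)) *ᵥ (P *ᵥ x) = 0 := by
    rw [Matrix.mulVec_mulVec, hP, Matrix.mul_smul, hker, smul_zero, Matrix.zero_mulVec]
  rw [Matrix.sub_mulVec, Matrix.smul_mulVec, Matrix.one_mulVec, sub_eq_zero] at hPx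
  exact Module.End.mem_eigenspace_iff.mpr hPx
end
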